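/- There exist unique elements ξ_I^− ∈ V ⊗ ℂ[z_1,…,z_n,h][D^{−1}], indexed by I ∈ ℐ_λ, such that ξ^−_{I^{max}} = v_{I^{max}} and ξ^−_{s_i(I)} = ŝ̃_i^− ξ^−_I for every I ∈ ℐ_λ and every i = 1,…,n−1. Moreover, ξ^−_I = Σ_{J ≥ I} X^−_{I,J} v_J with X^−_{I,J} ∈ ℂ[z_1,…,z_n,h][D^{−1}], X^−_{I,I} ≠ 0, and X^−_{I^{min},I^{min}} = R(z_{I^{min}})/Q(z_{I^{min}}). -/

import Mathlib

open scoped BigOperators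

noncomputable section

namespace GRTV

/-- The field `ℂ(z_1,…,z_n,h)` of rational functions. -/
abbrev K (n : ℕ) : Type := FractionRing (MvPolynomial (Fin n ⊕ Unit) ℂ)

/-- The variable `z_i`. -/
def z {n : ℕ} (i : Fin n) : K n :=
  algebraMap (MvPolynomial (Fin n ⊕ Unit) ℂ) (K n) (MvPolynomial.X (Sum.inl i))

/-- The variable `h`. -/
def hvar {n : ℕ} : K n :=
  algebraMap (MvPolynomial (Fin n ⊕ Unit) ℂ) (K n) (MvPolynomial.X (Sum.inr ()))

/-- The field automorphism of `ℂ(z_1,…,z_n,h)` permuting the variables `z_i` by `σ`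
(and fixing `h`); `f ↦ f^σ`. -/
def permK {n : ℕ} (σ : Equiv.Perm (Fin n)) : K n ≃+* K n :=
  IsFractionRing.ringEquivOfRingEquiv
    (MvPolynomial.renameEquiv ℂ (Equiv.sumCongr σ (Equiv.refl Unit))).toRingEquiv

/-- `V ⊗ ℂ(z_1,…,z_n,h)` in coordinates: a vector is the family of its coordinates
in the basis `{v_I}`, where a basis index (a decomposition `I`) is recorded as the word
`m : Fin n → Fin N` with `I_j = m⁻¹(j)`. -/
abbrev VV (n N : ℕ) : Type := (Fin n → Fin N) → K n

/-- `h` for the `+` case (`ε = true`) and `-h` for the `−` case (`ε = false`). -/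
def sign' {n : ℕ} (ε : Bool) : K n := if ε then hvar else -hvar

def fin1 {n : ℕ} (i : ℕ) (hi : i + 1 < n) : Fin n := ⟨i, Nat.lt_of_succ_lt hi⟩
def fin2 {n : ℕ} (i : ℕ) (hi : i + 1 < n) : Fin n := ⟨i + 1, hi⟩

/-- The operator `ŝ̃_i^±`:
`ŝ̃_i^± f = ((z_i−z_{i+1})P^{(i,i+1)} ∓ h)/(z_i−z_{i+1} ∓ h) · f^{s_i}`. -/
def tOp {n N : ℕ} (ε : Bool) (i : ℕ) (hi : i + 1 < n) (f : VV n N) : VV n N :=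
  fun m =>
    ((z (fin1 i hi) - z (fin2 i hi)) *
          permK (Equiv.swap (fin1 i hi) (fin2 i hi))
            (f (m ∘ ⇑(Equiv.swap (fin1 i hi) (fin2 i hi))))
        - sign' ε * permK (Equiv.swap (fin1 i hi) (fin2 i hi)) (f m))
      / (z (fin1 i hi) - z (fin2 i hi) - sign' ε)

/-- The block `I_a = {k : m k = a}` of the decomposition encoded by the word `m`. -/
def fib {n N : ℕ} (m : Fin n → Fin N) (a : Fin N) : Finset (Fin n) :=
  Finset.univ.filter (fun k => m k = a)

/-- `I ∈ ℐ_λ`, i.e. `|I_a| = λ_a` for all `a`. -/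
def memI {n N : ℕ} (lam : Fin N → ℕ) (m : Fin n → Fin N) : Prop :=
  ∀ a : Fin N, (fib m a).card = lam a

/-- The order on subsets of `{1,…,n}` of equal cardinality:
`A ≤ B` iff `a_j ≤ b_j` for all `j`, where `A = {a_1<⋯<a_m}`, `B = {b_1<⋯<b_m}`. -/
def subLE {n : ℕ} (A B : Finset (Fin n)) : Prop :=
  ∃ h : A.card = B.card,
    ∀ j : Fin A.card, (↑(A.orderIsoOfFin rfl j) : Fin n) ≤ ↑(B.orderIsoOfFin h.symm j)

/-- The strict order `I < J` on decompositions: `I_k = J_k` for `k < l` and `I_l < J_l`. -/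
def decLT {n N : ℕ} (mI mJ : Fin n → Fin N) : Prop :=
  ∃ l : Fin N, (∀ k : Fin N, k < l → fib mI k = fib mJ k) ∧
    subLE (fib mI l) (fib mJ l) ∧ fib mI l ≠ fib mJ l

/-- `I ≤ J` on decompositions. -/
def decLE {n N : ℕ} (mI mJ : Fin n → Fin N) : Prop :=
  decLT mI mJ ∨ mI = mJ

/-- `Q(z_I) = ∏_{1≤a<b≤N} ∏_{i∈I_a} ∏_{j∈I_b} (z_i−z_j+h)`. -/
def Qz {n N : ℕ} (m : Fin n → Fin N) : K n :=
  ∏ p ∈ Finset.univ.filter (fun p : Fin n × Fin n => m p.1 < m p.2),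
    (z p.1 - z p.2 + hvar)

/-- `R(z_I) = ∏_{1≤a<b≤N} ∏_{i∈I_a} ∏_{j∈I_b} (z_i−z_j)`. -/
def Rz {n N : ℕ} (m : Fin n → Fin N) : K n :=
  ∏ p ∈ Finset.univ.filter (fun p : Fin n × Fin n => m p.1 < m p.2),
    (z p.1 - z p.2)

/-- The basis vector `v_I` corresponding to the word `m0`. -/
def bas {n N : ℕ} (m0 : Fin n → Fin N) : VV n N :=
  fun m => if m = m0 then 1 else 0

/-- `D = ∏_{1≤i<j≤n}(z_i−z_j+h)`. -/
def Dpoly (n : ℕ) : K n :=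
  ∏ p ∈ Finset.univ.filter (fun p : Fin n × Fin n => p.1 < p.2), (z p.1 - z p.2 + hvar)

/-- `Ď = ∏_{1≤i<j≤n}(z_j−z_i+h)`. -/
def Dcheck (n : ℕ) : K n :=
  ∏ p ∈ Finset.univ.filter (fun p : Fin n × Fin n => p.1 < p.2), (z p.2 - z p.1 + hvar)

theorem hvar_add_ne {n : ℕ} (a b : Fin n) : z a - z b + hvar ≠ (0 : K n) := by
  intro h
  rw [z, z, hvar, ← map_sub, ← map_add] at h
  have h' := (IsFractionRing.injective (MvPolynomial (Fin n ⊕ Unit) ℂ) (K n))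
    (h.trans (map_zero _).symm)
  have := congrArg (MvPolynomial.eval (Sum.elim (fun _ => (0 : ℂ)) (fun _ => 1))) h'
  simp at this

theorem z_sub_ne {n : ℕ} {a b : Fin n} (hab : a ≠ b) : z a - z b ≠ (0 : K n) := by
  intro h
  rw [z, z, ← map_sub] at h
  have h' := (IsFractionRing.injective (MvPolynomial (Fin n ⊕ Unit) ℂ) (K n))
    (h.trans (map_zero _).symm)
  have := MvPolynomial.X_injective (sub_eq_zero.mp h')
  exact hab (Sum.inl_injective this)

theorem permK_algebraMap {n : ℕ} (σ : Equiv.Perm (Fin n))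
    (p : MvPolynomial (Fin n ⊕ Unit) ℂ) :
    permK σ (algebraMap _ (K n) p) =
      algebraMap _ (K n) (MvPolynomial.rename (Equiv.sumCongr σ (Equiv.refl Unit)) p) := by
  rw [permK, IsFractionRing.ringEquivOfRingEquiv_algebraMap]
  rfl

@[simp] theorem permK_z {n : ℕ} (σ : Equiv.Perm (Fin n)) (i : Fin n) :
    permK σ (z i) = z (σ i) := by
  rw [z, permK_algebraMap, MvPolynomial.rename_X]; rfl

@[simp] theorem permK_hvar {n : ℕ} (σ : Equiv.Perm (Fin n)) :
    permK σ hvar = (hvar : K n) := by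
  rw [hvar, permK_algebraMap, MvPolynomial.rename_X]; rfl

theorem permK_permK {n : ℕ} (σ τ : Equiv.Perm (Fin n)) (f : K n) :
    permK σ (permK τ f) = permK (σ * τ) f := by
  obtain ⟨p, q, -, rfl⟩ := IsFractionRing.div_surjective (A := MvPolynomial (Fin n ⊕ Unit) ℂ) f
  simp only [map_div₀, permK_algebraMap, MvPolynomial.rename_rename]
  have : (Equiv.sumCongr σ (Equiv.refl Unit) ∘ Equiv.sumCongr τ (Equiv.refl Unit) :
      Fin n ⊕ Unit → Fin n ⊕ Unit) = Equiv.sumCongr (σ * τ) (Equiv.refl Unit) := by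
    ext x; cases x <;> rfl
  rw [this]

@[simp] theorem permK_one {n : ℕ} (f : K n) : permK 1 f = f := by
  obtain ⟨p, q, -, rfl⟩ := IsFractionRing.div_surjective (A := MvPolynomial (Fin n ⊕ Unit) ℂ) f
  have : (Equiv.sumCongr (1 : Equiv.Perm (Fin n)) (Equiv.refl Unit) :
      Fin n ⊕ Unit → Fin n ⊕ Unit) = id := by
    ext x; cases x <;> rfl
  simp only [map_div₀, permK_algebraMap, this, MvPolynomial.rename_id, AlgHom.id_apply]

/-- The operator `((z_a−z_b)P^{(a,b)} + h)/(z_a−z_b + h) · f^{(a b)}`. -/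
def exchOp {n N : ℕ} (a b : Fin n) (f : VV n N) : VV n N := fun m =>
  ((z a - z b) * permK (Equiv.swap a b) (f (m ∘ Equiv.swap a b))
    + hvar * permK (Equiv.swap a b) (f m)) / (z a - z b + hvar)

theorem tOp_false {n N : ℕ} (i : ℕ) (hi : i + 1 < n) (f : VV n N) :
    tOp false i hi f = exchOp (fin1 i hi) (fin2 i hi) f := by
  funext m
  simp [tOp, exchOp, sign']

theorem comp_swap_swap {n N : ℕ} (m : Fin n → Fin N) (a b : Fin n) :
    (m ∘ Equiv.swap a b) ∘ Equiv.swap a b = m := by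
  funext k; simp

theorem exchOp_exchOp {n N : ℕ} {a b : Fin n} (f : VV n N) :
    exchOp a b (exchOp a b f) = f := by
  funext m
  have h1 := hvar_add_ne a b
  have h2 := hvar_add_ne b a
  simp only [exchOp, map_div₀, map_add, map_mul, map_sub, permK_z, permK_hvar, permK_permK,
    Equiv.swap_apply_left, Equiv.swap_apply_right, Equiv.swap_mul_self, permK_one, comp_swap_swap]
  field_simp
  ring

theorem swap_comm_swap {n : ℕ} {a b c d : Fin n} (hac : a ≠ c) (had : a ≠ d) (hbc : b ≠ c)
    (hbd : b ≠ d) : Equiv.swap a b * Equiv.swap c d = Equiv.swap c d * Equiv.swap a b := by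
  apply Equiv.Perm.Disjoint.commute
  intro k
  grind

theorem swap_braid {n : ℕ} {a b c : Fin n} (hab : a ≠ b) (hac : a ≠ c) (hbc : b ≠ c) :
    Equiv.swap b c * (Equiv.swap a b * Equiv.swap b c) =
      Equiv.swap a b * (Equiv.swap b c * Equiv.swap a b) := by
  ext k
  simp only [Equiv.Perm.mul_apply]
  grind

theorem comp_swap_braid {n N : ℕ} {a b c : Fin n} (hab : a ≠ b) (hac : a ≠ c) (hbc : b ≠ c)
    (m : Fin n → Fin N) :
    ((m ∘ Equiv.swap b c) ∘ Equiv.swap a b) ∘ Equiv.swap b c =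
      ((m ∘ Equiv.swap a b) ∘ Equiv.swap b c) ∘ Equiv.swap a b := by
  funext k
  exact congrArg (fun σ : Equiv.Perm (Fin n) => m (σ k)) (swap_braid hab hac hbc)

theorem comp_swap_comm {n N : ℕ} {a b c d : Fin n} (hac : a ≠ c) (had : a ≠ d) (hbc : b ≠ c)
    (hbd : b ≠ d) (m : Fin n → Fin N) :
    (m ∘ Equiv.swap c d) ∘ Equiv.swap a b = (m ∘ Equiv.swap a b) ∘ Equiv.swap c d := by
  funext k
  exact congrArg (fun σ : Equiv.Perm (Fin n) => m (σ k)) (swap_comm_swap hac had hbc hbd).symm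

theorem exchOp_comm {n N : ℕ} {a b c d : Fin n} (hac : a ≠ c) (had : a ≠ d) (hbc : b ≠ c)
    (hbd : b ≠ d) (f : VV n N) :
    exchOp a b (exchOp c d f) = exchOp c d (exchOp a b f) := by
  have hc := swap_comm_swap hac had hbc hbd
  have hm := comp_swap_comm (N := N) hac had hbc hbd
  funext m
  have h1 := hvar_add_ne a b
  have h2 := hvar_add_ne c d
  simp only [exchOp, map_div₀, map_add, map_mul, map_sub, permK_z, permK_hvar, permK_permK,
    Equiv.swap_apply_of_ne_of_ne hac had, Equiv.swap_apply_of_ne_of_ne hbc hbd,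
    Equiv.swap_apply_of_ne_of_ne hac.symm hbc.symm, Equiv.swap_apply_of_ne_of_ne had.symm hbd.symm,
    hc, hm]
  field_simp
  ring

/-- The Yang–Baxter equation. -/
theorem exchOp_braid {n N : ℕ} {a b c : Fin n} (hab : a ≠ b) (hac : a ≠ c) (hbc : b ≠ c)
    (f : VV n N) :
    exchOp a b (exchOp b c (exchOp a b f)) = exchOp b c (exchOp a b (exchOp b c f)) := by
  have hc := swap_braid hab hac hbc
  have hm := comp_swap_braid (N := N) hab hac hbc
  funext m
  have h1 := hvar_add_ne a b
  have h2 := hvar_add_ne b c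
  have h3 := hvar_add_ne a c
  simp only [exchOp, map_div₀, map_add, map_mul, map_sub, permK_z, permK_hvar, permK_permK,
    Equiv.swap_apply_left, Equiv.swap_apply_right,
    Equiv.swap_apply_of_ne_of_ne hac.symm hbc.symm, Equiv.swap_apply_of_ne_of_ne hab hac,
    hc, hm, comp_swap_swap]
  field_simp
  ring

/-- Pairs of positions at which the word `m` is increasing. -/
def incPairs {n N : ℕ} (m : Fin n → Fin N) : Finset (Fin n × Fin n) :=
  Finset.univ.filter (fun p => p.1 < p.2 ∧ m p.1 < m p.2)

theorem mem_incPairs {n N : ℕ} {m : Fin n → Fin N} {p : Fin n × Fin n} :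
    p ∈ incPairs m ↔ p.1 < p.2 ∧ m p.1 < m p.2 := by
  simp [incPairs]

theorem swap_lt_swap {n : ℕ} {i : ℕ} {hi : i + 1 < n} {p q : Fin n}
    (h : ¬ (p = fin1 i hi ∧ q = fin2 i hi)) (hpq : p < q) :
    Equiv.swap (fin1 i hi) (fin2 i hi) p < Equiv.swap (fin1 i hi) (fin2 i hi) q := by
  simp only [Equiv.swap_apply_def, Fin.ext_iff, Fin.lt_def, fin1, fin2] at *
  split_ifs <;> simp <;> omega

theorem incPairs_eq_cons {n N : ℕ} {m : Fin n → Fin N} {i : ℕ} {hi : i + 1 < n}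
    (h : m (fin1 i hi) < m (fin2 i hi)) :
    ∃ hn, incPairs m = Finset.cons (fin1 i hi, fin2 i hi)
      ((incPairs (m ∘ Equiv.swap (fin1 i hi) (fin2 i hi))).map
        ((Equiv.swap (fin1 i hi) (fin2 i hi)).prodCongr
          (Equiv.swap (fin1 i hi) (fin2 i hi))).toEmbedding) hn := by
  have hlt : fin1 i hi < fin2 i hi := by simp [fin1, fin2]
  set s := Equiv.swap (fin1 i hi) (fin2 i hi) with hs
  have hss (k) : s (s k) = k := Equiv.swap_apply_self _ _ _
  have hmem (p : Fin n × Fin n) : p ∈ ((incPairs (m ∘ s)).map (s.prodCongr s).toEmbedding) ↔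
      s p.1 < s p.2 ∧ m p.1 < m p.2 := by
    rw [Finset.mem_map_equiv, mem_incPairs]
    simp [hs]
  refine ⟨?_, ?_⟩
  · rw [hmem]
    simp [hs, hlt.le]
  · ext ⟨p, q⟩
    rw [Finset.mem_cons, hmem, mem_incPairs, Prod.mk.injEq]
    constructor
    · rintro ⟨h1, h2⟩
      by_cases hc : p = fin1 i hi ∧ q = fin2 i hi
      · exact Or.inl hc
      · exact Or.inr ⟨swap_lt_swap hc h1, h2⟩
    · rintro (⟨rfl, rfl⟩ | ⟨h1, h2⟩)
      · exact ⟨hlt, h⟩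
      · refine ⟨?_, h2⟩
        have := swap_lt_swap (i := i) (hi := hi) (p := s p) (q := s q) ?_ h1
        · rwa [← hs, hss, hss] at this
        · rintro ⟨h3, h4⟩
          have h3' : p = fin2 i hi := by rw [← hss p, h3]; simp [hs]
          have h4' : q = fin1 i hi := by rw [← hss q, h4]; simp [hs]
          subst h3' h4'
          exact absurd h (not_lt.mpr h2.le)

theorem card_incPairs_lt {n N : ℕ} {m : Fin n → Fin N} {i : ℕ} {hi : i + 1 < n}
    (h : m (fin1 i hi) < m (fin2 i hi)) :
    (incPairs (m ∘ Equiv.swap (fin1 i hi) (fin2 i hi))).card < (incPairs m).card := by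
  obtain ⟨hn, he⟩ := incPairs_eq_cons h
  rw [he, Finset.card_cons, Finset.card_map]
  exact Nat.lt_succ_self _

open Classical in
/-- The vectors `ξ_I^−`, for all decompositions `I`. -/
def xi {n N : ℕ} (m : Fin n → Fin N) : VV n N :=
  if h : ∃ (i : ℕ) (hi : i + 1 < n), m (fin1 i hi) < m (fin2 i hi) then
    exchOp (fin1 h.choose h.choose_spec.choose) (fin2 h.choose h.choose_spec.choose)
      (xi (m ∘ Equiv.swap (fin1 h.choose h.choose_spec.choose)
        (fin2 h.choose h.choose_spec.choose)))
  else bas m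
termination_by (incPairs m).card
decreasing_by exact card_incPairs_lt h.choose_spec.choose_spec

theorem xi_of_no_ascent {n N : ℕ} {m : Fin n → Fin N}
    (h : ¬ ∃ (i : ℕ) (hi : i + 1 < n), m (fin1 i hi) < m (fin2 i hi)) : xi m = bas m := by
  rw [xi, dif_neg h]

theorem exists_xi_eq {n N : ℕ} {m : Fin n → Fin N}
    (h : ∃ (i : ℕ) (hi : i + 1 < n), m (fin1 i hi) < m (fin2 i hi)) :
    ∃ (i : ℕ) (hi : i + 1 < n), m (fin1 i hi) < m (fin2 i hi) ∧
      xi m = exchOp (fin1 i hi) (fin2 i hi) (xi (m ∘ Equiv.swap (fin1 i hi) (fin2 i hi))) :=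
  ⟨h.choose, h.choose_spec.choose, h.choose_spec.choose_spec, by rw [xi, dif_pos h]⟩

theorem exchOp_bas {n N : ℕ} {m : Fin n → Fin N} {a b : Fin n} (h : m a = m b) :
    exchOp a b (bas m) = bas m := by
  have hm : m ∘ Equiv.swap a b = m := by
    funext k
    simp only [Function.comp, Equiv.swap_apply_def]
    split_ifs with h1 h2 <;> simp_all
  funext m'
  have h1 : (m' ∘ Equiv.swap a b = m) ↔ m' = m := by
    constructor
    · intro h; rw [← comp_swap_swap m' a b, h, hm]
    · rintro rfl; exact hm
  have h2 := hvar_add_ne a b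
  simp only [exchOp, bas, h1]
  split_ifs
  · simp [div_self h2]
  · simp

theorem eq_fin12 {n : ℕ} {a b : Fin n} (hab : a.val + 1 = b.val) :
    ∃ hi : a.val + 1 < n, a = fin1 a.val hi ∧ b = fin2 a.val hi :=
  ⟨hab ▸ b.isLt, rfl, Fin.ext hab.symm⟩

theorem card_incPairs_swap_lt {n N : ℕ} {m : Fin n → Fin N} {a b : Fin n}
    (hab : a.val + 1 = b.val) (h : m a < m b) :
    (incPairs (m ∘ Equiv.swap a b)).card < (incPairs m).card := by
  obtain ⟨hi, ha, hb⟩ := eq_fin12 hab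
  rw [hb] at h ⊢
  exact card_incPairs_lt h

/-- `ξ_m` satisfies the defining recursion at each ascent of `m` and is invariant at each
repetition of `m`. -/
def XiRec {n N : ℕ} (m : Fin n → Fin N) : Prop :=
  ∀ a b : Fin n, a.val + 1 = b.val →
    (m a < m b → xi m = exchOp a b (xi (m ∘ Equiv.swap a b))) ∧
    (m a = m b → exchOp a b (xi m) = xi m)

theorem exchOp_xi_braid {n N : ℕ} {m : Fin n → Fin N}
    (ih : ∀ m' : Fin n → Fin N, (incPairs m').card < (incPairs m).card → XiRec m')
    {a b c : Fin n} (hab : a.val + 1 = b.val) (hbc : b.val + 1 = c.val)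
    (h1 : m a < m b) (h2 : m b < m c) :
    exchOp a b (xi (m ∘ Equiv.swap a b)) = exchOp b c (xi (m ∘ Equiv.swap b c)) := by
  have nab : a ≠ b := by rintro rfl; omega
  have nac : a ≠ c := by rintro rfl; omega
  have nbc : b ≠ c := by rintro rfl; omega
  have e1 := Equiv.swap_apply_of_ne_of_ne nac.symm nbc.symm
  have e2 := Equiv.swap_apply_of_ne_of_ne nab nac
  have l1 := card_incPairs_swap_lt hab h1
  have l2 := card_incPairs_swap_lt hbc h2
  have g1 : (m ∘ Equiv.swap a b) b < (m ∘ Equiv.swap a b) c := by simpa [e1] using h1.trans h2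
  have g2 : (m ∘ Equiv.swap b c) a < (m ∘ Equiv.swap b c) b := by simpa [e2] using h1.trans h2
  have l3 := card_incPairs_swap_lt hbc g1
  have l4 := card_incPairs_swap_lt hab g2
  have g3 : ((m ∘ Equiv.swap a b) ∘ Equiv.swap b c) a <
      ((m ∘ Equiv.swap a b) ∘ Equiv.swap b c) b := by simpa [e1, e2] using h2
  have g4 : ((m ∘ Equiv.swap b c) ∘ Equiv.swap a b) b <
      ((m ∘ Equiv.swap b c) ∘ Equiv.swap a b) c := by simpa [e1, e2] using h1
  rw [((ih _ l1) b c hbc).1 g1, ((ih _ (l3.trans l1)) a b hab).1 g3,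
    ((ih _ l2) a b hab).1 g2, ((ih _ (l4.trans l2)) b c hbc).1 g4,
    exchOp_braid nab nac nbc, comp_swap_braid nab nac nbc]

theorem exchOp_xi_comm {n N : ℕ} {m : Fin n → Fin N}
    (ih : ∀ m' : Fin n → Fin N, (incPairs m').card < (incPairs m).card → XiRec m')
    {a b c d : Fin n} (hab : a.val + 1 = b.val) (hcd : c.val + 1 = d.val) (hbc : b < c)
    (h1 : m a < m b) (h2 : m c < m d) :
    exchOp a b (xi (m ∘ Equiv.swap a b)) = exchOp c d (xi (m ∘ Equiv.swap c d)) := by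
  have nac : a ≠ c := by rintro rfl; omega
  have nad : a ≠ d := by rintro rfl; omega
  have nbc : b ≠ c := by rintro rfl; omega
  have nbd : b ≠ d := by rintro rfl; omega
  have e1 := Equiv.swap_apply_of_ne_of_ne nac nad
  have e2 := Equiv.swap_apply_of_ne_of_ne nbc nbd
  have e3 := Equiv.swap_apply_of_ne_of_ne nac.symm nbc.symm
  have e4 := Equiv.swap_apply_of_ne_of_ne nad.symm nbd.symm
  rw [((ih _ (card_incPairs_swap_lt hab h1)) c d hcd).1 (by simpa [e3, e4] using h2),
    ((ih _ (card_incPairs_swap_lt hcd h2)) a b hab).1 (by simpa [e1, e2] using h1),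
    exchOp_comm nac nad nbc nbd, comp_swap_comm nac nad nbc nbd]

theorem exchOp_xi_of_eq {n N : ℕ} {m : Fin n → Fin N}
    (ih : ∀ m' : Fin n → Fin N, (incPairs m').card < (incPairs m).card → XiRec m')
    {a b c d : Fin n} (hab : a.val + 1 = b.val) (hcd : c.val + 1 = d.val)
    (h1 : m a = m b) (h2 : m c < m d) (hm : xi m = exchOp c d (xi (m ∘ Equiv.swap c d))) :
    exchOp a b (xi m) = xi m := by
  have lt := card_incPairs_swap_lt hcd h2
  rcases lt_trichotomy b c with hbc | rfl | hbc
  · have nac : a ≠ c := by rintro rfl; omega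
    have nad : a ≠ d := by rintro rfl; omega
    have nbc : b ≠ c := by rintro rfl; omega
    have nbd : b ≠ d := by rintro rfl; omega
    have e1 := Equiv.swap_apply_of_ne_of_ne nac nad
    have e2 := Equiv.swap_apply_of_ne_of_ne nbc nbd
    rw [hm, exchOp_comm nac nad nbc nbd, (ih _ lt a b hab).2 (by simpa [e1, e2] using h1)]
  · have nab : a ≠ b := by rintro rfl; omega
    have nad : a ≠ d := by rintro rfl; omega
    have nbd : b ≠ d := by rintro rfl; omega
    have e1 := Equiv.swap_apply_of_ne_of_ne nad.symm nbd.symm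
    have e2 := Equiv.swap_apply_of_ne_of_ne nab nad
    have g : (m ∘ Equiv.swap b d) a < (m ∘ Equiv.swap b d) b := by simpa [e2, h1] using h2
    have lt' := card_incPairs_swap_lt hab g
    rw [hm, (ih _ lt a b hab).1 g, exchOp_braid nab nad nbd,
      (ih _ (lt'.trans lt) b d hcd).2 (by simpa [e1, e2] using h1)]
  · have nca : c ≠ b := by rintro rfl; omega
    rcases eq_or_ne c a with rfl | nca'
    · have : b = d := Fin.ext (hab.symm.trans hcd)
      subst this
      exact absurd h2 (by simp [h1])
    rcases eq_or_ne d a with rfl | nda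
    · have ncd : c ≠ d := by rintro rfl; omega
      have ndb : d ≠ b := by rintro rfl; omega
      have e1 := Equiv.swap_apply_of_ne_of_ne nca.symm ndb.symm
      have e2 := Equiv.swap_apply_of_ne_of_ne ncd nca
      have g : (m ∘ Equiv.swap c d) d < (m ∘ Equiv.swap c d) b := by simpa [e1, ← h1] using h2
      have lt' := card_incPairs_swap_lt hab g
      rw [hm, (ih _ lt d b hab).1 g, ← exchOp_braid ncd nca ndb,
        (ih _ (lt'.trans lt) c d hcd).2 (by simpa [e1, e2] using h1)]
    · have ndb : d ≠ b := by rintro rfl; exact nca' (Fin.ext (by omega))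
      have e1 := Equiv.swap_apply_of_ne_of_ne nca'.symm nda.symm
      have e2 := Equiv.swap_apply_of_ne_of_ne nca.symm ndb.symm
      rw [hm, exchOp_comm nca'.symm nda.symm nca.symm ndb.symm,
        (ih _ lt a b hab).2 (by simpa [e1, e2] using h1)]

theorem xiRec {n N : ℕ} (m : Fin n → Fin N) : XiRec m := by
  induction hk : (incPairs m).card using Nat.strong_induction_on generalizing m with
  | _ k ih =>
  subst hk
  replace ih := fun m' h => ih _ h m' rfl
  intro a b hab
  by_cases hasc : ∃ (i : ℕ) (hi : i + 1 < n), m (fin1 i hi) < m (fin2 i hi)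
  · obtain ⟨j, hj, hlt, hm⟩ := exists_xi_eq hasc
    have hcd : (fin1 j hj).val + 1 = (fin2 j hj).val := rfl
    generalize fin1 j hj = c at *
    generalize fin2 j hj = d at *
    refine ⟨fun h => ?_, fun h => exchOp_xi_of_eq ih hab hcd h hlt hm⟩
    rw [hm]
    rcases lt_trichotomy b c with hbc | rfl | hbc
    · exact (exchOp_xi_comm ih hab hcd hbc h hlt).symm
    · exact (exchOp_xi_braid ih hab hcd h hlt).symm
    · rcases lt_trichotomy d a with hda | rfl | hda
      · exact exchOp_xi_comm ih hcd hab hda hlt h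
      · exact exchOp_xi_braid ih hcd hab hlt h
      · have h1 : a = c := Fin.ext (by omega)
        have h2 : b = d := Fin.ext (by omega)
        rw [h1, h2]
  · obtain ⟨hi, ha, hb⟩ := eq_fin12 hab
    refine ⟨fun h => (hasc ⟨a.val, hi, by rwa [← ha, ← hb]⟩).elim, fun h => ?_⟩
    rw [xi_of_no_ascent hasc, exchOp_bas h]

theorem xi_swap {n N : ℕ} (m : Fin n → Fin N) {a b : Fin n} (hab : a.val + 1 = b.val) :
    xi (m ∘ Equiv.swap a b) = exchOp a b (xi m) := by
  rcases lt_trichotomy (m a) (m b) with h | h | h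
  · rw [(xiRec m a b hab).1 h, exchOp_exchOp]
  · rw [(xiRec m a b hab).2 h]
    congr 1
    funext k
    simp only [Function.comp, Equiv.swap_apply_def]
    split_ifs with h1 h2 <;> simp_all
  · have := (xiRec (m ∘ Equiv.swap a b) a b hab).1 (by simpa using h)
    rwa [comp_swap_swap] at this

theorem antitone_of_no_ascent {n N : ℕ} {m : Fin n → Fin N}
    (h : ¬ ∃ (i : ℕ) (hi : i + 1 < n), m (fin1 i hi) < m (fin2 i hi)) : Antitone m := by
  push Not at h
  intro p q hpq
  obtain ⟨p, hp⟩ := p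
  obtain ⟨q, hq⟩ := q
  change p ≤ q at hpq
  induction q, hpq using Nat.le_induction with
  | base => exact le_rfl
  | succ k hk ihk => exact (h k hq).trans (ihk _)

theorem no_ascent_of_antitone {n N : ℕ} {m : Fin n → Fin N} (hm : Antitone m) :
    ¬ ∃ (i : ℕ) (hi : i + 1 < n), m (fin1 i hi) < m (fin2 i hi) := by
  rintro ⟨i, hi, h⟩
  exact absurd (hm (show fin1 i hi ≤ fin2 i hi by simp [fin1, fin2])) (not_le.mpr h)

theorem mem_fib {n N : ℕ} {m : Fin n → Fin N} {a : Fin N} {k : Fin n} :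
    k ∈ fib m a ↔ m k = a := by
  simp [fib]

theorem antitone_unique {n N : ℕ} {lam : Fin N → ℕ} {m m' : Fin n → Fin N}
    (h : memI lam m) (h' : memI lam m') (hm : Antitone m) (hm' : Antitone m') : m = m' := by
  apply List.ofFn_injective
  refine List.Perm.eq_of_pairwise (le := (· ≥ ·)) (fun _ _ _ _ h1 h2 => le_antisymm h2 h1)
    (List.pairwise_ofFn.mpr fun i j hij => hm hij.le)
    (List.pairwise_ofFn.mpr fun i j hij => hm' hij.le) ?_
  have key (m : Fin n → Fin N) (a : Fin N) : (List.ofFn m).count a = (fib m a).card := by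
    rw [← Multiset.coe_count, ← Fin.univ_val_map, Multiset.count_map, fib, Finset.card_def,
      Finset.filter_val]
    simp only [eq_comm]
  rw [List.perm_iff_count]
  intro a
  rw [key, key, h a, h' a]

theorem memI_comp {n N : ℕ} {lam : Fin N → ℕ} {m : Fin n → Fin N} (h : memI lam m)
    (σ : Equiv.Perm (Fin n)) : memI lam (m ∘ σ) := by
  intro a
  rw [← h a]
  exact Finset.card_equiv σ fun k => by simp [mem_fib]

/-- The product of the denominators `z_a - z_b + h` over the increasing pairs of `m`. -/
def incDen {n N : ℕ} (m : Fin n → Fin N) : K n :=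
  ∏ p ∈ incPairs m, (z p.1 - z p.2 + hvar)

/-- Induction along ascents, starting from the antitone words. -/
theorem ascent_induction {n N : ℕ} {P : (Fin n → Fin N) → Prop}
    (h0 : ∀ m, Antitone m → P m)
    (h1 : ∀ m (i : ℕ) (hi : i + 1 < n), m (fin1 i hi) < m (fin2 i hi) →
      P (m ∘ Equiv.swap (fin1 i hi) (fin2 i hi)) → P m) (m : Fin n → Fin N) : P m := by
  induction hk : (incPairs m).card using Nat.strong_induction_on generalizing m with
  | _ k ih =>
  by_cases h : ∃ (i : ℕ) (hi : i + 1 < n), m (fin1 i hi) < m (fin2 i hi)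
  · obtain ⟨i, hi, hlt⟩ := h
    exact h1 m i hi hlt (ih _ (hk ▸ card_incPairs_lt hlt) _ rfl)
  · exact h0 m (antitone_of_no_ascent h)

theorem xi_ascent {n N : ℕ} {m : Fin n → Fin N} {i : ℕ} {hi : i + 1 < n}
    (h : m (fin1 i hi) < m (fin2 i hi)) :
    xi m = exchOp (fin1 i hi) (fin2 i hi) (xi (m ∘ Equiv.swap (fin1 i hi) (fin2 i hi))) :=
  (xiRec m _ _ rfl).1 h

theorem incDen_ascent {n N : ℕ} {m : Fin n → Fin N} {i : ℕ} {hi : i + 1 < n}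
    (h : m (fin1 i hi) < m (fin2 i hi)) :
    incDen m = (z (fin1 i hi) - z (fin2 i hi) + hvar) *
      permK (Equiv.swap (fin1 i hi) (fin2 i hi))
        (incDen (m ∘ Equiv.swap (fin1 i hi) (fin2 i hi))) := by
  obtain ⟨hn, he⟩ := incPairs_eq_cons h
  rw [incDen, he, Finset.prod_cons, Finset.prod_map, incDen, map_prod]
  simp

theorem exists_xi_mul_incDen {n N : ℕ} (m m' : Fin n → Fin N) :
    ∃ p : MvPolynomial (Fin n ⊕ Unit) ℂ, xi m m' * incDen m = algebraMap _ (K n) p := by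
  induction m using ascent_induction generalizing m' with
  | h0 m hm =>
    have he : incPairs m = ∅ := by
      ext p
      simp only [mem_incPairs, Finset.notMem_empty, iff_false, not_and, not_lt]
      exact fun h => hm h.le
    rw [xi_of_no_ascent (no_ascent_of_antitone hm), incDen, he, bas]
    split_ifs
    · exact ⟨1, by simp⟩
    · exact ⟨0, by simp⟩
  | h1 m i hi h ih =>
    obtain ⟨p, hp⟩ := ih (m' ∘ Equiv.swap (fin1 i hi) (fin2 i hi))
    obtain ⟨q, hq⟩ := ih m'
    have hp' := congrArg (permK (Equiv.swap (fin1 i hi) (fin2 i hi))) hp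
    have hq' := congrArg (permK (Equiv.swap (fin1 i hi) (fin2 i hi))) hq
    rw [map_mul, permK_algebraMap] at hp' hq'
    refine ⟨(MvPolynomial.X (Sum.inl (fin1 i hi)) - MvPolynomial.X (Sum.inl (fin2 i hi))) *
      MvPolynomial.rename (Equiv.sumCongr (Equiv.swap (fin1 i hi) (fin2 i hi)) (Equiv.refl Unit)) p
      + MvPolynomial.X (Sum.inr ()) * MvPolynomial.rename
        (Equiv.sumCongr (Equiv.swap (fin1 i hi) (fin2 i hi)) (Equiv.refl Unit)) q, ?_⟩
    rw [map_add, map_mul, map_mul, ← hp', ← hq', map_sub, incDen_ascent h, xi_ascent h, exchOp]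
    change _ = (z _ - z _) * _ + hvar * _
    have h1 := hvar_add_ne (fin1 i hi) (fin2 i hi)
    field_simp

theorem exists_xi_eq_div_Dpoly {n N : ℕ} (m m' : Fin n → Fin N) :
    ∃ (p : MvPolynomial (Fin n ⊕ Unit) ℂ) (k : ℕ),
      xi m m' = algebraMap (MvPolynomial (Fin n ⊕ Unit) ℂ) (K n) p / Dpoly n ^ k := by
  obtain ⟨p, hp⟩ := exists_xi_mul_incDen m m'
  have hD : Dpoly n ≠ 0 := Finset.prod_ne_zero_iff.mpr fun p _ => hvar_add_ne _ _
  have hsub : incPairs m ⊆ Finset.univ.filter (fun p : Fin n × Fin n => p.1 < p.2) := by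
    intro p hp
    simpa using (mem_incPairs.mp hp).1
  obtain ⟨q, hq⟩ : ∃ q : MvPolynomial (Fin n ⊕ Unit) ℂ, algebraMap _ (K n) q =
      ∏ q ∈ Finset.univ.filter (fun p : Fin n × Fin n => p.1 < p.2) \ incPairs m,
        (z q.1 - z q.2 + hvar) := by
    refine ⟨∏ q ∈ Finset.univ.filter (fun p : Fin n × Fin n => p.1 < p.2) \ incPairs m,
      (MvPolynomial.X (Sum.inl q.1) - MvPolynomial.X (Sum.inl q.2)
        + MvPolynomial.X (Sum.inr ())), ?_⟩
    rw [map_prod]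
    refine Finset.prod_congr rfl fun q _ => ?_
    rw [map_add, map_sub, z, z, hvar]
  refine ⟨p * q, 1, ?_⟩
  rw [pow_one, eq_div_iff hD, map_mul, hq, ← hp, Dpoly, ← Finset.prod_sdiff hsub, incDen,
    mul_assoc]
  exact congrArg _ (mul_comm _ _)

theorem subLE_iff {n : ℕ} {A B : Finset (Fin n)} :
    subLE A B ↔ A.card = B.card ∧
      ∀ t : ℕ, (B.filter (fun k => k.val < t)).card ≤ (A.filter (fun k => k.val < t)).card := by
  have key (C : Finset (Fin n)) {c : ℕ} (hc : C.card = c) (t : ℕ) :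
      (C.filter (fun k => k.val < t)).card =
        (Finset.univ.filter (fun j => (C.orderEmbOfFin hc j).val < t)).card := by
    conv_lhs => rw [← Finset.map_orderEmbOfFin_univ C hc, Finset.filter_map, Finset.card_map]
    rfl
  constructor
  · rintro ⟨h, hle⟩
    refine ⟨h, fun t => ?_⟩
    rw [key A rfl, key B h.symm]
    refine Finset.card_le_card fun j hj => ?_
    simp only [Finset.mem_filter, Finset.mem_univ, true_and] at hj ⊢
    exact lt_of_le_of_lt (hle j) hj
  · rintro ⟨h, hle⟩
    refine ⟨h, fun j => ?_⟩
    by_contra hlt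
    rw [not_le] at hlt
    simp only [Finset.coe_orderIsoOfFin_apply] at hlt
    have h1 := hle ((B.orderEmbOfFin h.symm j).val + 1)
    rw [key A rfl, key B h.symm] at h1
    have h2 : (Finset.Iic j).card ≤ (Finset.univ.filter (fun j' =>
        (B.orderEmbOfFin h.symm j').val < (B.orderEmbOfFin h.symm j).val + 1)).card := by
      refine Finset.card_le_card fun j' hj' => ?_
      simp only [Finset.mem_filter, Finset.mem_univ, true_and, Finset.mem_Iic] at hj' ⊢
      exact Nat.lt_succ_of_le ((B.orderEmbOfFin h.symm).monotone hj')
    have h3 : (Finset.univ.filter (fun j' =>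
        (A.orderEmbOfFin rfl j').val < (B.orderEmbOfFin h.symm j).val + 1)).card ≤
          (Finset.Iio j).card := by
      refine Finset.card_le_card fun j' hj' => ?_
      simp only [Finset.mem_filter, Finset.mem_univ, true_and, Finset.mem_Iio] at hj' ⊢
      exact (A.orderEmbOfFin rfl).lt_iff_lt.mp
        (lt_of_le_of_lt (Fin.le_def.mpr (Nat.lt_succ_iff.mp hj')) hlt)
    rw [Fin.card_Iic] at h2
    rw [Fin.card_Iio] at h3
    omega

/-- The number of letters `a` among the first `t` letters of `m`. -/
def cnt {n N : ℕ} (m : Fin n → Fin N) (a : Fin N) (t : ℕ) : ℕ :=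
  ((fib m a).filter (fun k => k.val < t)).card

theorem cnt_succ {n N : ℕ} (m : Fin n → Fin N) (a : Fin N) (k : Fin n) :
    cnt m a (k.val + 1) = cnt m a k.val + if m k = a then 1 else 0 := by
  have : (fib m a).filter (fun j => j.val < k.val + 1) =
      (fib m a).filter (fun j => j.val < k.val) ∪ (if m k = a then {k} else ∅) := by
    ext j
    rw [Finset.mem_union]
    split_ifs with h <;>
      simp only [Finset.mem_filter, mem_fib, Finset.mem_singleton, Finset.notMem_empty]
    · constructor
      · rintro ⟨h1, h2⟩
        by_cases hjk : j = k
        · exact Or.inr hjk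
        · exact Or.inl ⟨h1, by rw [Fin.ext_iff] at hjk; omega⟩
      · rintro (⟨h1, h2⟩ | rfl)
        · exact ⟨h1, by omega⟩
        · exact ⟨h, by omega⟩
    · constructor
      · rintro ⟨h1, h2⟩
        have : j.val ≠ k.val := fun hh => h (Fin.ext hh ▸ h1)
        exact Or.inl ⟨h1, by omega⟩
      · rintro (⟨h1, h2⟩ | h1)
        · exact ⟨h1, by omega⟩
        · exact h1.elim
  rw [cnt, this, Finset.card_union_of_disjoint, cnt]
  · split_ifs <;> simp
  · split_ifs <;> simp

theorem cnt_comp_swap {n N : ℕ} (m : Fin n → Fin N) (l : Fin N) {a b : Fin n}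
    (hab : a.val + 1 = b.val) {t : ℕ} (ht : t ≠ b.val) :
    cnt (m ∘ Equiv.swap a b) l t = cnt m l t := by
  refine Finset.card_equiv (Equiv.swap a b) fun k => ?_
  simp only [Finset.mem_filter, mem_fib, Function.comp_apply, and_congr_right_iff]
  intro _
  rw [Equiv.swap_apply_def]
  split_ifs with h1 h2
  · subst h1; omega
  · subst h2; omega
  · rfl

/-- `I < J` expressed by letter counts: at the first differing letter `l`, every prefix of `m`
has at least as many letters `l` as the same prefix of `m'`. -/
theorem decLT_iff {n N : ℕ} {lam : Fin N → ℕ} {m m' : Fin n → Fin N} (hm : memI lam m)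
    (hm' : memI lam m') : decLT m m' ↔ ∃ l : Fin N, (∀ k < l, fib m k = fib m' k) ∧
      (∀ t, cnt m' l t ≤ cnt m l t) ∧ fib m l ≠ fib m' l := by
  simp only [decLT, subLE_iff, cnt, hm _, hm' _, true_and]

theorem fib_eq_of_cnt_eq {n N : ℕ} {m m' : Fin n → Fin N} {l : Fin N}
    (h : ∀ t, cnt m l t = cnt m' l t) : fib m l = fib m' l := by
  ext k
  have h1 := cnt_succ m l k
  have h2 := cnt_succ m' l k
  rw [h, h, h2] at h1
  rw [mem_fib, mem_fib]
  by_cases c1 : m k = l <;> by_cases c2 : m' k = l <;> simp_all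

theorem decLT_trans {n N : ℕ} {lam : Fin N → ℕ} {m₁ m₂ m₃ : Fin n → Fin N} (h₁ : memI lam m₁)
    (h₂ : memI lam m₂) (h₃ : memI lam m₃) (h : decLT m₁ m₂) (h' : decLT m₂ m₃) :
    decLT m₁ m₃ := by
  rw [decLT_iff h₁ h₂] at h
  rw [decLT_iff h₂ h₃] at h'
  rw [decLT_iff h₁ h₃]
  obtain ⟨l, hl, hc, hn⟩ := h
  obtain ⟨l', hl', hc', hn'⟩ := h'
  rcases lt_trichotomy l l' with hll | rfl | hll
  · exact ⟨l, fun k hk => (hl k hk).trans (hl' k (hk.trans hll)),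
      fun t => by simpa only [cnt, ← hl' l hll] using hc t, hl' l hll ▸ hn⟩
  · refine ⟨l, fun k hk => (hl k hk).trans (hl' k hk), fun t => (hc' t).trans (hc t), ?_⟩
    intro he
    apply hn
    refine fib_eq_of_cnt_eq fun t => le_antisymm ?_ (hc t)
    simpa only [cnt, he] using hc' t
  · exact ⟨l', fun k hk => (hl k (hk.trans hll)).trans (hl' k hk),
      fun t => by simpa only [cnt, hl l' hll] using hc' t, (hl l' hll).symm ▸ hn'⟩

theorem not_decLT_self {n N : ℕ} (m : Fin n → Fin N) : ¬ decLT m m := by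
  rintro ⟨l, -, -, h⟩
  exact h rfl

theorem fib_comp_eq_iff {n N : ℕ} (m m' : Fin n → Fin N) (l : Fin N) (σ : Equiv.Perm (Fin n)) :
    fib (m ∘ σ) l = fib (m' ∘ σ) l ↔ fib m l = fib m' l := by
  simp only [Finset.ext_iff, mem_fib, Function.comp_apply]
  exact σ.forall_congr_right (q := fun k => m k = l ↔ m' k = l)

theorem cnt_succ_of_eq {n N : ℕ} (m : Fin n → Fin N) (l : Fin N) {a b : Fin n}
    (hab : a.val + 1 = b.val) : cnt m l b.val = cnt m l a.val + if m a = l then 1 else 0 := by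
  rw [← hab, cnt_succ]

theorem decLT_comp_swap {n N : ℕ} {lam : Fin N → ℕ} {m : Fin n → Fin N} (hm : memI lam m)
    {a b : Fin n} (hab : a.val + 1 = b.val) (h : m a < m b) :
    decLT m (m ∘ Equiv.swap a b) := by
  rw [decLT_iff hm (memI_comp hm _)]
  refine ⟨m a, fun k hk => ?_, fun t => ?_, fun he => ?_⟩
  · ext j
    simp only [mem_fib, Function.comp_apply, Equiv.swap_apply_def]
    split_ifs with h1 h2
    · subst h1; simp [hk.ne', (hk.trans h).ne']
    · subst h2; simp [hk.ne', (hk.trans h).ne']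
    · rfl
  · by_cases ht : t = b.val
    · subst ht
      rw [cnt_succ_of_eq _ _ hab, cnt_succ_of_eq _ _ hab, cnt_comp_swap m _ hab (by omega)]
      simp [h.ne']
    · rw [cnt_comp_swap m _ hab ht]
  · have : a ∈ fib (m ∘ Equiv.swap a b) (m a) := he ▸ mem_fib.mpr rfl
    rw [mem_fib] at this
    simp [h.ne'] at this

theorem decLE_of_comp_swap {n N : ℕ} {lam : Fin N → ℕ} {m m' : Fin n → Fin N}
    (hm : memI lam m) (hm' : memI lam m') {a b : Fin n} (hab : a.val + 1 = b.val)
    (h : m a < m b) (hle : decLE (m ∘ Equiv.swap a b) (m' ∘ Equiv.swap a b)) :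
    decLE m m' := by
  rcases hle with hlt | he
  · left
    rw [decLT_iff (memI_comp hm _) (memI_comp hm' _)] at hlt
    obtain ⟨l, hl, hc, hn⟩ := hlt
    simp only [fib_comp_eq_iff] at hl
    rw [ne_eq, fib_comp_eq_iff] at hn
    rw [decLT_iff hm hm']
    refine ⟨l, hl, fun t => ?_, hn⟩
    have hct (t : ℕ) (ht : t ≠ b.val) : cnt m' l t ≤ cnt m l t := by
      have := hc t
      rwa [cnt_comp_swap m _ hab ht, cnt_comp_swap m' _ hab ht] at this
    by_cases ht : t = b.val
    · subst ht
      have c1 := hct a.val (by omega)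
      have c2 := hct (b.val + 1) (by omega)
      rw [cnt_succ, cnt_succ, cnt_succ_of_eq _ _ hab, cnt_succ_of_eq _ _ hab] at c2
      rw [cnt_succ_of_eq _ _ hab, cnt_succ_of_eq _ _ hab]
      have hb : m b = l → m' a ≠ l := by
        rintro rfl ha
        have : a ∈ fib m' (m a) := hl (m a) h ▸ mem_fib.mpr rfl
        rw [mem_fib, ha] at this
        exact h.ne' this
      by_cases q1 : m a = l <;> by_cases q2 : m b = l <;> by_cases q3 : m' a = l <;>
        by_cases q4 : m' b = l <;> simp_all <;> omega
    · exact hct t ht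
  · right
    rw [← comp_swap_swap m a b, he, comp_swap_swap]

theorem xi_triangular {n N : ℕ} {lam : Fin N → ℕ} (m : Fin n → Fin N) (hm : memI lam m)
    (m' : Fin n → Fin N) (h : xi m m' ≠ 0) : memI lam m' ∧ decLE m m' := by
  induction m using ascent_induction generalizing m' with
  | h0 m hanti =>
    rw [xi_of_no_ascent (no_ascent_of_antitone hanti), bas] at h
    have : m' = m := by by_contra hc; simp [hc] at h
    subst this
    exact ⟨hm, Or.inr rfl⟩
  | h1 m i hi hlt ih =>
    replace ih := ih (memI_comp hm _)
    have hab : (fin1 i hi).val + 1 = (fin2 i hi).val := rfl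
    rw [xi_ascent hlt] at h
    generalize fin1 i hi = a at *
    generalize fin2 i hi = b at *
    by_cases c1 : xi (m ∘ Equiv.swap a b) (m' ∘ Equiv.swap a b) = 0
    · by_cases c2 : xi (m ∘ Equiv.swap a b) m' = 0
      · simp [exchOp, c1, c2] at h
      · obtain ⟨g1, g2⟩ := ih _ c2
        refine ⟨g1, Or.inl ?_⟩
        have g3 := decLT_comp_swap hm hab hlt
        rcases g2 with g2 | g2
        · exact decLT_trans hm (memI_comp hm _) g1 g3 g2
        · exact g2 ▸ g3
    · obtain ⟨g1, g2⟩ := ih _ c1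
      have g3 : memI lam m' := by
        have := memI_comp g1 (Equiv.swap a b)
        rwa [comp_swap_swap] at this
      exact ⟨g3, decLE_of_comp_swap hm g3 hab hlt g2⟩

theorem xi_diag {n N : ℕ} (m : Fin n → Fin N) :
    xi m m = ∏ p ∈ incPairs m, ((z p.1 - z p.2) / (z p.1 - z p.2 + hvar)) := by
  induction m using ascent_induction with
  | h0 m hm =>
    have he : incPairs m = ∅ := by
      ext p
      simp only [mem_incPairs, Finset.notMem_empty, iff_false, not_and, not_lt]
      exact fun h => hm h.le
    rw [xi_of_no_ascent (no_ascent_of_antitone hm), he, bas]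
    simp
  | h1 m i hi hlt ih =>
    have hm : memI (fun a => (fib m a).card) m := fun _ => rfl
    have h0 : xi (m ∘ Equiv.swap (fin1 i hi) (fin2 i hi)) m = 0 := by
      by_contra hne
      have h1 := decLT_comp_swap hm (a := fin1 i hi) (b := fin2 i hi) rfl hlt
      obtain ⟨-, h2 | h2⟩ := xi_triangular _ (memI_comp hm _) _ hne
      · exact not_decLT_self _ (decLT_trans hm (memI_comp hm _) hm h1 h2)
      · rw [h2] at h1
        exact not_decLT_self _ h1
    obtain ⟨hn, he⟩ := incPairs_eq_cons hlt
    rw [xi_ascent hlt, exchOp, h0, ih, map_prod, he, Finset.prod_cons, Finset.prod_map]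
    simp only [map_div₀, map_add, map_sub, permK_z, permK_hvar, map_zero, mul_zero, add_zero,
      Equiv.coe_toEmbedding, Equiv.prodCongr_apply, Prod.map_fst, Prod.map_snd]
    rw [mul_div_right_comm]

/-- existence and uniqueness of the vectors `ξ_I^−`, `I ∈ ℐ_λ`, with
`ξ^−_{I^max} = v_{I^max}` and `ξ^−_{s_i(I)} = ŝ̃_i^− ξ^−_I`, together with the
triangularity properties.  Here `m0` encodes `I^min` (the unique monotone decomposition
in `ℐ_λ`) and `m1` encodes `I^max` (the unique antitone one). -/
theorem statement7 (n N : ℕ) (lam : Fin N → ℕ) (hlam : ∑ a : Fin N, lam a = n)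
    (m0 : Fin n → Fin N) (hm0 : memI lam m0) (hm0mono : Monotone m0)
    (m1 : Fin n → Fin N) (hm1 : memI lam m1) (hm1anti : Antitone m1) :
    ∃ ξ : (Fin n → Fin N) → VV n N,
      -- defining properties
      (ξ m1 = bas m1) ∧
      (∀ m, memI lam m → ∀ (i : ℕ) (hi : i + 1 < n),
        ξ (m ∘ ⇑(Equiv.swap (fin1 i hi) (fin2 i hi))) = tOp false i hi (ξ m)) ∧
      -- uniqueness (on ℐ_λ)
      (∀ ξ' : (Fin n → Fin N) → VV n N,
        ξ' m1 = bas m1 →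
        (∀ m, memI lam m → ∀ (i : ℕ) (hi : i + 1 < n),
          ξ' (m ∘ ⇑(Equiv.swap (fin1 i hi) (fin2 i hi))) = tOp false i hi (ξ' m)) →
        ∀ m, memI lam m → ξ' m = ξ m) ∧
      -- coefficients lie in ℂ[z_1,…,z_n,h][D⁻¹]
      (∀ m m' : Fin n → Fin N, ∃ (p : MvPolynomial (Fin n ⊕ Unit) ℂ) (k : ℕ),
        ξ m m' = algebraMap (MvPolynomial (Fin n ⊕ Unit) ℂ) (K n) p / Dpoly n ^ k) ∧
      -- triangularity: ξ^−_I = Σ_{J ≥ I} X^−_{I,J} v_J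
      (∀ m, memI lam m → ∀ m' : Fin n → Fin N,
        ¬ (memI lam m' ∧ decLE m m') → ξ m m' = 0) ∧
      -- X^−_{I,I} ≠ 0
      (∀ m, memI lam m → ξ m m ≠ 0) ∧
      -- X^−_{I^min,I^min} = R(z_{I^min})/Q(z_{I^min})
      (ξ m0 m0 = Rz m0 / Qz m0) := by
  have hxi (m : Fin n → Fin N) (i : ℕ) (hi : i + 1 < n) :
      xi (m ∘ ⇑(Equiv.swap (fin1 i hi) (fin2 i hi))) = tOp false i hi (xi m) := by
    rw [tOp_false, xi_swap m rfl]
  have h1 : xi m1 = bas m1 := xi_of_no_ascent (no_ascent_of_antitone hm1anti)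
  refine ⟨xi, h1, fun m _ => hxi m, ?_, exists_xi_eq_div_Dpoly, ?_, ?_, ?_⟩
  · intro ξ' hmax hrec m hm
    induction m using ascent_induction with
    | h0 m hanti => rw [antitone_unique hm hm1 hanti hm1anti, hmax, h1]
    | h1 m i hi hlt ih =>
      have hs := memI_comp hm (Equiv.swap (fin1 i hi) (fin2 i hi))
      have h2 := hrec _ hs i hi
      rwa [ih hs, ← hxi, comp_swap_swap] at h2
  · intro m hm m' hnot
    by_contra hne
    exact hnot (xi_triangular m hm m' hne)
  · intro m _
    rw [xi_diag, Finset.prod_ne_zero_iff]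
    exact fun p hp => div_ne_zero (z_sub_ne (mem_incPairs.mp hp).1.ne) (hvar_add_ne _ _)
  · have he : incPairs m0 =
        Finset.univ.filter (fun p : Fin n × Fin n => m0 p.1 < m0 p.2) := by
      ext p
      simp only [mem_incPairs, Finset.mem_filter, Finset.mem_univ, true_and,
        and_iff_right_iff_imp]
      exact fun h => hm0mono.reflect_lt h
    rw [xi_diag, he, Finset.prod_div_distrib, Rz, Qz]

end GRTV
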